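/- There exist constants c > 0 and λ₁ > 0 such that for every λ ≥ λ₁ the quotient standard map SM₀ : 𝕋² → 𝕋², induced by (x,y) ↦ (x + y + λ sin x, y + λ sin x) modulo 2π in both coordinates, has topological entropy at least c·log λ. -/

import Mathlib

open Real

/-- On `[-1, 1]`, the sine expands distances by a factor at least `1 / 2`. -/
lemma abs_sub_le_two_mul_abs_sin_sub {u v : ℝ} (hu : |u| ≤ 1) (hv : |v| ≤ 1) :
    |u - v| ≤ 2 * |sin u - sin v| := by
  wlog huv : u ≤ v generalizing u v
  · rw [abs_sub_comm u, abs_sub_comm (sin u)]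
    exact this hv hu (le_of_not_ge huv)
  have h := (convex_Icc (-1 : ℝ) 1).mul_sub_le_image_sub_of_le_deriv (f := sin) (C := 1 / 2)
    continuous_sin.continuousOn differentiable_sin.differentiableOn
    (fun x hx ↦ by
      rw [interior_Icc] at hx
      have := one_sub_sq_div_two_le_cos (x := x)
      rw [Real.deriv_sin]
      nlinarith [hx.1, hx.2])
    u (abs_le.1 hu) v (abs_le.1 hv) huv
  rw [abs_sub_comm u, abs_sub_comm (sin u), abs_of_nonneg (sub_nonneg.2 huv)]
  linarith [le_abs_self (sin v - sin u)]

lemma abs_arcsin_le_one {w : ℝ} (hw : |w| ≤ 3 / 4) : |arcsin w| ≤ 1 := by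
  have h1 : 3 / 4 ≤ sin 1 := by
    have := sin_gt_sub_cube one_pos
    norm_num at this ⊢
    linarith
  have hpi := pi_gt_three
  have h2 : arcsin (sin 1) = 1 := arcsin_sin (by linarith) (by linarith)
  obtain ⟨hl, hr⟩ := abs_le.1 hw
  rw [abs_le]
  constructor
  · rw [← h2, ← arcsin_neg]
    exact monotone_arcsin (by linarith)
  · rw [← h2]
    exact monotone_arcsin (by linarith)

/-- For `lam ≥ 16` and every periodic sequence `b` with values in `[-lam / 2, lam / 2]`, the
second-order recurrence of the standard map, forced by `b`, has a periodic solution with values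
in `[-1, 1]`. -/
lemma exists_periodic_solution {lam : ℝ} (hlam : 16 ≤ lam) {n : ℕ} [NeZero n] (b : ZMod n → ℝ)
    (hb : ∀ i, |b i| ≤ lam / 2) :
    ∃ x : ZMod n → ℝ, (∀ i, |x i| ≤ 1) ∧
      ∀ i, lam * sin (x i) = b i + x (i + 1) - 2 * x i + x (i - 1) := by
  have hpos : 0 < lam := by linarith
  set A : (ZMod n → ℝ) → ZMod n → ℝ :=
    fun x i ↦ (b i + x (i + 1) - 2 * x i + x (i - 1)) / lam with hA
  set T : (ZMod n → ℝ) → ZMod n → ℝ := fun x i ↦ arcsin (A x i) with hT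
  set s : Set (ZMod n → ℝ) := {x | ∀ i, |x i| ≤ 1} with hs
  have hAbound : ∀ x ∈ s, ∀ i, |A x i| ≤ 3 / 4 := by
    intro x hx i
    have h1 := abs_le.1 (hx (i + 1))
    have h2 := abs_le.1 (hx i)
    have h3 := abs_le.1 (hx (i - 1))
    have h4 := abs_le.1 (hb i)
    simp only [hA]
    rw [abs_div, abs_of_pos hpos, div_le_iff₀ hpos, abs_le]
    constructor <;> linarith
  have hmaps : Set.MapsTo T s s := fun x hx i ↦ abs_arcsin_le_one (hAbound x hx i)
  have hsin : ∀ x ∈ s, ∀ i, sin (T x i) = A x i := fun x hx i ↦ by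
    have := abs_le.1 (hAbound x hx i)
    exact sin_arcsin (by linarith) (by linarith)
  have hclosed : IsClosed s := by
    rw [hs, Set.ofPred_forall]
    exact isClosed_iInter fun i ↦ isClosed_le (by fun_prop) continuous_const
  have hcontr : ContractingWith (1 / 2) (hmaps.restrict T s s) := by
    refine ⟨by rw [← NNReal.coe_lt_coe]; norm_num, LipschitzWith.of_dist_le_mul ?_⟩
    rintro ⟨x, hx⟩ ⟨y, hy⟩
    change dist (T x) (T y) ≤ _ * dist x y
    have hd : ∀ i, |x i - y i| ≤ dist x y := fun i ↦ by
      rw [← Real.dist_eq]; exact dist_le_pi_dist x y i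
    refine (dist_pi_le_iff (by positivity)).2 fun i ↦ ?_
    rw [Real.dist_eq]
    refine (abs_sub_le_two_mul_abs_sin_sub (hmaps hx i) (hmaps hy i)).trans ?_
    rw [hsin x hx, hsin y hy]
    have h1 := abs_le.1 (hd (i + 1))
    have h2 := abs_le.1 (hd i)
    have h3 := abs_le.1 (hd (i - 1))
    have h0 : 0 ≤ dist x y := dist_nonneg
    have : |A x i - A y i| ≤ 1 / 4 * dist x y := by
      simp only [hA]
      rw [← sub_div, abs_div, abs_of_pos hpos, div_le_iff₀ hpos, abs_le]
      constructor <;> nlinarith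
    push_cast
    linarith
  obtain ⟨x, hx, hfix, -⟩ := hcontr.exists_fixedPoint' hclosed.isComplete hmaps (x := 0)
    (by simp [hs]) (edist_ne_top _ _)
  refine ⟨x, hx, fun i ↦ ?_⟩
  have h := hsin x hx i
  rw [hfix.eq] at h
  rw [h]
  simp only [hA]
  field_simp

/-- A periodic solution of the forced recurrence with forcing in `2πℤ` projects to an orbit of the
standard map. -/
lemma iterate_eq_of_periodic_solution {lam : ℝ}
    {F : AddCircle (2 * π) × AddCircle (2 * π) → AddCircle (2 * π) × AddCircle (2 * π)}
    (hF : ∀ x y : ℝ, F ((x : AddCircle (2 * π)), (y : AddCircle (2 * π))) =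
      (((x + y + lam * sin x : ℝ) : AddCircle (2 * π)), ((y + lam * sin x : ℝ) : AddCircle (2 * π))))
    {n : ℕ} (k : ZMod n → ℕ) {x : ZMod n → ℝ}
    (hx : ∀ i, lam * sin (x i) = k i * (2 * π) + x (i + 1) - 2 * x i + x (i - 1)) (m : ℕ) :
    F^[m] ((x 0 : AddCircle (2 * π)), ((x 0 - x (-1) : ℝ) : AddCircle (2 * π))) =
      ((x m : AddCircle (2 * π)), ((x m - x (m - 1) : ℝ) : AddCircle (2 * π))) := by
  induction m with
  | zero => simp
  | succ m ih =>
    have key : ∀ z : ℝ, ((z + k m * (2 * π) : ℝ) : AddCircle (2 * π)) = z := fun z ↦ by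
      rw [← nsmul_eq_mul, AddCircle.coe_add, AddCircle.coe_nsmul, AddCircle.coe_period, smul_zero,
        add_zero]
    rw [Function.iterate_succ_apply', ih, hF, hx, Nat.cast_succ, add_sub_cancel_right]
    rw [← key (x (m + 1)), ← key (x (m + 1) - x m)]
    congr 2 <;> ring

/-- Points of the circle `ℝ / 2πℤ` with representatives in `[-1, 1]` are as far apart as these
representatives. -/
lemma dist_addCircle_coe_eq_abs_sub {u v : ℝ} (hu : |u| ≤ 1) (hv : |v| ≤ 1) :
    dist (u : AddCircle (2 * π)) (v : AddCircle (2 * π)) = |u - v| := by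
  have hpi := pi_gt_three
  rw [dist_eq_norm, ← AddCircle.coe_sub, AddCircle.norm_coe_eq_abs_iff _ (by positivity),
    abs_of_pos (by positivity : 0 < 2 * π)]
  linarith [abs_sub u v]

/-- Two solutions of the forced recurrence that stay within `2 / (lam + 4)` of each other have the
same forcing. -/
lemma forcing_eq_of_close {lam : ℝ} (hlam : 0 < lam) {n : ℕ} {k l : ZMod n → ℕ} {x y : ZMod n → ℝ}
    (hx : ∀ i, lam * sin (x i) = k i * (2 * π) + x (i + 1) - 2 * x i + x (i - 1))
    (hy : ∀ i, lam * sin (y i) = l i * (2 * π) + y (i + 1) - 2 * y i + y (i - 1))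
    (hxy : ∀ i, |x i - y i| ≤ 2 / (lam + 4)) : k = l := by
  funext i
  by_contra hne
  have hint : (1 : ℝ) ≤ |(k i : ℝ) - l i| := by
    have : (1 : ℤ) ≤ |(k i : ℤ) - l i| := Int.one_le_abs (by omega)
    exact_mod_cast this
  have hpi := pi_gt_three
  have hsin : |sin (x i) - sin (y i)| ≤ 2 / (lam + 4) :=
    (abs_sin_sub_sin_le (x i) (y i)).trans (hxy i)
  have h0 := abs_le.1 hsin
  have h1 := abs_le.1 (hxy (i + 1))
  have h2 := abs_le.1 (hxy i)
  have h3 := abs_le.1 (hxy (i - 1))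
  have hd : (lam + 4) * (2 / (lam + 4)) = 2 := by field_simp
  set d := 2 / (lam + 4)
  have heq : ((k i : ℝ) - l i) * (2 * π) = lam * (sin (x i) - sin (y i))
      - (x (i + 1) - y (i + 1)) + 2 * (x i - y i) - (x (i - 1) - y (i - 1)) := by
    linarith [hx i, hy i]
  have hle : |((k i : ℝ) - l i) * (2 * π)| ≤ 2 := by
    rw [heq, abs_le]
    constructor <;> nlinarith
  rw [abs_mul, abs_of_pos (by positivity : 0 < 2 * π)] at hle
  nlinarith

/-- If `2πM ≤ lam / 2`, the standard map has at least `(M + 1) ^ n` points whose orbits of length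
`n` are separated at scale `1 / (lam + 4)`. -/
lemma pow_le_netMaxcard_standard_map {lam : ℝ} (hlam : 16 ≤ lam)
    {F : AddCircle (2 * π) × AddCircle (2 * π) → AddCircle (2 * π) × AddCircle (2 * π)}
    (hF : ∀ x y : ℝ, F ((x : AddCircle (2 * π)), (y : AddCircle (2 * π))) =
      (((x + y + lam * sin x : ℝ) : AddCircle (2 * π)), ((y + lam * sin x : ℝ) : AddCircle (2 * π))))
    {M : ℕ} (hM : M * (2 * π) ≤ lam / 2) (n : ℕ) [NeZero n] :
    ((M + 1) ^ n : ℕ) ≤ Dynamics.netMaxcard F Set.univ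
      {p | dist p.1 p.2 < 1 / (lam + 4)} n := by
  classical
  have hex : ∀ k : ZMod n → Fin (M + 1), ∃ x : ZMod n → ℝ, (∀ i, |x i| ≤ 1) ∧
      ∀ i, lam * sin (x i) = (k i : ℕ) * (2 * π) + x (i + 1) - 2 * x i + x (i - 1) := fun k ↦ by
    refine exists_periodic_solution hlam (fun i ↦ (k i : ℕ) * (2 * π)) fun i ↦ ?_
    rw [abs_of_nonneg (by positivity)]
    refine le_trans ?_ hM
    gcongr
    exact_mod_cast Nat.lt_succ_iff.1 (k i).2
  choose x hx1 hx2 using hex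
  set P : (ZMod n → Fin (M + 1)) → AddCircle (2 * π) × AddCircle (2 * π) :=
    fun k ↦ ((x k 0 : AddCircle (2 * π)), ((x k 0 - x k (-1) : ℝ) : AddCircle (2 * π))) with hP
  have hiter (k : ZMod n → Fin (M + 1)) (j : ZMod n) : (F^[j.val] (P k)).1 = x k j := by
    rw [hP, iterate_eq_of_periodic_solution hF (fun i ↦ (k i : ℕ)) (hx2 k), ZMod.natCast_zmod_val]
  have hsep : ∀ k l z, (∀ m < n, dist (F^[m] (P k)) (F^[m] z) < 1 / (lam + 4)) →
      (∀ m < n, dist (F^[m] (P l)) (F^[m] z) < 1 / (lam + 4)) → k = l := by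
    intro k l z hk hl
    have h := forcing_eq_of_close (by linarith) (hx2 k) (hx2 l) fun j ↦ by
      rw [← dist_addCircle_coe_eq_abs_sub (hx1 k j) (hx1 l j), ← hiter, ← hiter]
      have h1 := hk j.val (ZMod.val_lt j)
      have h2 := hl j.val (ZMod.val_lt j)
      have h3 := dist_triangle_right (F^[j.val] (P k)) (F^[j.val] (P l)) (F^[j.val] z)
      have h4 : dist (F^[j.val] (P k)).1 (F^[j.val] (P l)).1 ≤
        dist (F^[j.val] (P k)) (F^[j.val] (P l)) := le_max_left _ _
      have h5 : 2 / (lam + 4) = 1 / (lam + 4) + 1 / (lam + 4) := by ring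
      linarith
    funext i
    exact Fin.ext (congrFun h i)
  have hε : 0 < 1 / (lam + 4) := by
    have : 0 < lam + 4 := by linarith
    positivity
  have hinj : Function.Injective P := fun k l hkl ↦
    hsep k l (P k) (fun m _ ↦ by rwa [dist_self]) (fun m _ ↦ by rwa [hkl, dist_self])
  have hnet : Dynamics.IsDynNetIn F Set.univ {p | dist p.1 p.2 < 1 / (lam + 4)} n
      (Finset.univ.image P : Finset _) := by
    refine ⟨Set.subset_univ _, ?_⟩
    rintro p hp q hq hpq
    obtain ⟨k, -, rfl⟩ := Finset.mem_image.1 (Finset.mem_coe.1 hp)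
    obtain ⟨l, -, rfl⟩ := Finset.mem_image.1 (Finset.mem_coe.1 hq)
    refine Set.disjoint_left.2 fun z hzk hzl ↦ hpq (congrArg P (hsep k l z ?_ ?_))
    · exact Dynamics.mem_ball_dynEntourage.1 hzk
    · exact Dynamics.mem_ball_dynEntourage.1 hzl
  have hcard := hnet.card_le_netMaxcard
  rw [Finset.card_image_of_injective _ hinj] at hcard
  simpa using hcard

/-- For large `λ`, the quotient standard map on the torus `𝕋² = ℝ²/(2πℤ²)` has
topological entropy at least `c · log λ`. -/
theorem standard_map_entropy_lower_bound :
    ∃ c > (0 : ℝ), ∃ lam₁ > (0 : ℝ), ∀ lam : ℝ, lam ≥ lam₁ →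
      ∀ F : AddCircle (2 * π) × AddCircle (2 * π) →
            AddCircle (2 * π) × AddCircle (2 * π),
        (∀ x y : ℝ,
          F ((x : AddCircle (2 * π)), (y : AddCircle (2 * π))) =
            (((x + y + lam * Real.sin x : ℝ) : AddCircle (2 * π)),
             ((y + lam * Real.sin x : ℝ) : AddCircle (2 * π)))) →
        ((c * Real.log lam : ℝ) : EReal) ≤ Dynamics.coverEntropy F Set.univ := by
  refine ⟨1 / 2, by norm_num, 256, by norm_num, fun lam hlam F hF ↦ ?_⟩
  have hpos : 0 < lam := by linarith
  set M : ℕ := ⌊lam / (4 * π)⌋₊ with hMdef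
  have hM : M * (2 * π) ≤ lam / 2 := by
    have h : (M : ℝ) ≤ lam / (4 * π) := Nat.floor_le (by positivity)
    rw [le_div_iff₀ (by positivity)] at h
    linarith
  have hsqrt : √lam ≤ (M + 1 : ℕ) := by
    have h : lam / (4 * π) < (M + 1 : ℕ) := by exact_mod_cast Nat.lt_floor_add_one _
    refine le_trans ?_ h.le
    rw [le_div_iff₀ (by positivity)]
    have h16 : 16 ≤ √lam := Real.le_sqrt_of_sq_le (by linarith)
    nlinarith [Real.mul_self_sqrt hpos.le, pi_lt_four]
  have hU : {p : (AddCircle (2 * π) × AddCircle (2 * π)) × (AddCircle (2 * π) × AddCircle (2 * π)) |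
      dist p.1 p.2 < 1 / (lam + 4)} ∈ uniformity (AddCircle (2 * π) × AddCircle (2 * π)) :=
    Metric.dist_mem_uniformity (by positivity)
  refine le_trans ?_ (Dynamics.netEntropyEntourage_le_coverEntropy F Set.univ hU)
  have hgrowth : ExpGrowth.expGrowthSup (fun n ↦ ((M + 1 : ℕ) : ENNReal) ^ n) ≤
      Dynamics.netEntropyEntourage F Set.univ {p | dist p.1 p.2 < 1 / (lam + 4)} := by
    refine ExpGrowth.expGrowthSup_eventually_monotone ?_
    filter_upwards [Filter.eventually_ne_atTop 0] with n hn
    have : NeZero n := ⟨hn⟩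
    have h := pow_le_netMaxcard_standard_map (by linarith) hF hM n
    have h' := ENat.toENNReal_mono h
    simpa using h'
  refine le_trans ?_ hgrowth
  rw [ExpGrowth.expGrowthSup_pow, ← ENNReal.ofReal_natCast,
    ENNReal.log_ofReal_of_pos (by positivity), EReal.coe_le_coe_iff]
  refine le_trans (le_of_eq ?_) (Real.log_le_log (by positivity) hsqrt)
  rw [Real.log_sqrt hpos.le]
  ring
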